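/- arXiv:2504.08050 — 8 statements merged into one kernel-verified Lean document; each statement's English description precedes it below -/
import Mathlib

section
/- Let L be a field of characteristic zero, let f, g ∈ L[t] be polynomials, and let a, b, t₀ ∈ L with a·t₀ + b ≠ 0. Set x₀ := (a·t₀+b)²/3 and y₀ := (a·t₀+b)³/6 + f(t₀)/(2·(a·t₀+b)). Then y₀² = x₀³ + f(t₀)·x₀ + g(t₀) if and only if P(t₀) = 0. -/
/-- The polynomial `P(t) = −f(t)²/4 + (a·t+b)⁴·f(t)/6 + (a·t+b)²·g(t) + (a·t+b)⁸/108`. -/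
noncomputable def Ppoly {L : Type*} [Field L] (a b : L) (f g : Polynomial L) : Polynomial L :=
  -(Polynomial.C (1 / 4 : L)) * f ^ 2
    + Polynomial.C (1 / 6 : L) * (Polynomial.C a * Polynomial.X + Polynomial.C b) ^ 4 * f
    + (Polynomial.C a * Polynomial.X + Polynomial.C b) ^ 2 * g
    + Polynomial.C (1 / 108 : L) * (Polynomial.C a * Polynomial.X + Polynomial.C b) ^ 8

/-- The point `Q = (x₀, y₀, t₀)` with `x₀ = (at₀+b)²/3` and
`y₀ = (at₀+b)³/6 + f(t₀)/(2(at₀+b))` lies on the surface `y² = x³ + f(t)x + g(t)`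
if and only if `P(t₀) = 0`. -/
theorem stmt_0 {L : Type*} [Field L] [CharZero L] (f g : Polynomial L)
    (a b t₀ : L) (hab : a * t₀ + b ≠ 0)
    (x₀ y₀ : L)
    (hx₀ : x₀ = (a * t₀ + b) ^ 2 / 3)
    (hy₀ : y₀ = (a * t₀ + b) ^ 3 / 6 + f.eval t₀ / (2 * (a * t₀ + b))) :
    y₀ ^ 2 = x₀ ^ 3 + f.eval t₀ * x₀ + g.eval t₀ ↔ (Ppoly a b f g).eval t₀ = 0 := by
  have key : (Ppoly a b f g).eval t₀ =
      (a * t₀ + b) ^ 2 * (x₀ ^ 3 + f.eval t₀ * x₀ + g.eval t₀ - y₀ ^ 2) := by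
    simp only [Ppoly, Polynomial.eval_add, Polynomial.eval_mul, Polynomial.eval_neg,
      Polynomial.eval_pow, Polynomial.eval_C, Polynomial.eval_X, hx₀, hy₀]
    field_simp
    ring
  rw [key, mul_eq_zero, or_iff_right (pow_ne_zero 2 hab), sub_eq_zero, eq_comm]
end

section
/- Let L be a field of characteristic zero, let f, g ∈ L[t], let a, b, c, d, h ∈ L, and let t₀ ∈ L with t₀·(a·t₀+b) ≠ 0. Set x₀ := (a·t₀+b)²/3. Then for e ∈ L, the first partial derivative ∂H/∂x vanishes at (x₀, t₀) if and only if e = (f(t₀) − (a·t₀+b)⁴/3 − 2·(a·t₀+b)·(c·t₀³ + d·t₀² + h)) / (2·t₀·(a·t₀+b)). -/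
/-- The polynomial `H(x,t) = x³ + f(t)·x + g(t) − (a·x·t + b·x + c·t³ + d·t² + e·t + h)²`
as a multivariate polynomial over `L` in the two variables `X 0 = x` and `X 1 = t`. -/
noncomputable def Hpoly {L : Type*} [Field L] (a b c d e h : L) (f g : Polynomial L) :
    MvPolynomial (Fin 2) L :=
  (MvPolynomial.X 0) ^ 3
    + Polynomial.aeval (MvPolynomial.X 1) f * MvPolynomial.X 0
    + Polynomial.aeval (MvPolynomial.X 1) g
    - (MvPolynomial.C a * MvPolynomial.X 0 * MvPolynomial.X 1
        + MvPolynomial.C b * MvPolynomial.X 0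
        + MvPolynomial.C c * MvPolynomial.X 1 ^ 3
        + MvPolynomial.C d * MvPolynomial.X 1 ^ 2
        + MvPolynomial.C e * MvPolynomial.X 1
        + MvPolynomial.C h) ^ 2

theorem eval_aeval_X {R σ : Type*} [CommRing R] (v : σ → R) (i : σ) (p : Polynomial R) :
    MvPolynomial.eval v (Polynomial.aeval (MvPolynomial.X i) p) = p.eval (v i) := by
  rw [← MvPolynomial.coe_aeval_eq_eval, RingHom.coe_coe, ← Polynomial.aeval_algHom_apply,
    MvPolynomial.aeval_X, Polynomial.coe_aeval_eq_eval]

theorem eval_pderiv_zero_Hpoly {L : Type*} [Field L] (a b c d e h x t : L) (f g : Polynomial L) :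
    MvPolynomial.eval ![x, t] (MvPolynomial.pderiv 0 (Hpoly a b c d e h f g)) =
      3 * x ^ 2 + f.eval t
        - 2 * (a * x * t + b * x + c * t ^ 3 + d * t ^ 2 + e * t + h) * (a * t + b) := by
  have h_ne : (1 : Fin 2) ≠ 0 := one_ne_zero
  simp [Hpoly, eval_aeval_X, MvPolynomial.pderiv_X_of_ne h_ne, Derivation.leibniz_pow]
  ring

/-- Condition (C3): with `x₀ = (at₀+b)²/3`, the derivative `∂H/∂x` vanishes at `(x₀,t₀)`
if and only if `e = (f(t₀) − (at₀+b)⁴/3 − 2(at₀+b)(ct₀³ + dt₀² + h)) / (2t₀(at₀+b))`. -/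
theorem stmt_2 {L : Type*} [Field L] [CharZero L] (f g : Polynomial L)
    (a b c d h t₀ : L) (ht : t₀ * (a * t₀ + b) ≠ 0)
    (x₀ : L) (hx₀ : x₀ = (a * t₀ + b) ^ 2 / 3) (e : L) :
    MvPolynomial.eval ![x₀, t₀] (MvPolynomial.pderiv 0 (Hpoly a b c d e h f g)) = 0 ↔
      e = (f.eval t₀ - (a * t₀ + b) ^ 4 / 3
            - 2 * (a * t₀ + b) * (c * t₀ ^ 3 + d * t₀ ^ 2 + h)) / (2 * t₀ * (a * t₀ + b)) := by
  obtain ⟨ht₀, hm⟩ := mul_ne_zero_iff.mp ht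
  have h_den : 2 * t₀ * (a * t₀ + b) ≠ 0 := mul_ne_zero (mul_ne_zero two_ne_zero ht₀) hm
  rw [eval_pderiv_zero_Hpoly, eq_div_iff h_den, hx₀]
  constructor <;> intro H <;> linear_combination -H
end

section
/- Let L be a field of characteristic zero, let f, g ∈ L[t], let a, b, c, h ∈ L, and let t₀ ∈ L with t₀·(a·t₀+b) ≠ 0. Set x₀ := (a·t₀+b)²/3, set d := [ (a·t₀+b)⁴·(b − 2·a·t₀)/3 + 2·(a·t₀+b)²·(h − 2·c·t₀³) + (a·t₀+b)·(t₀·f′(t₀) − f(t₀)) − a·t₀·f(t₀) ] / (2·t₀²·(a·t₀+b)²), and set e := (f(t₀) − (a·t₀+b)⁴/3 − 2·(a·t₀+b)·(c·t₀³ + d·t₀² + h)) / (2·t₀·(a·t₀+b)). Then the mixed second partial derivative ∂²H/∂t∂x vanishes at (x₀, t₀). -/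
/-- Evaluating the multivariate polynomial `p(q)` amounts to evaluating `p` at the value of `q`. -/
theorem MvPolynomial.eval_polynomial_aeval {σ R : Type*} [CommSemiring R] (v : σ → R)
    (p : Polynomial R) (q : MvPolynomial σ R) :
    eval v (Polynomial.aeval q p) = p.eval (eval v q) := by
  rw [← MvPolynomial.coe_aeval_eq_eval, RingHom.coe_coe, ← Polynomial.aeval_algHom_apply,
    Polynomial.coe_aeval_eq_eval]

/-- The mixed second partial derivative of `Hpoly` in closed form. -/
theorem eval_pderiv_pderiv_Hpoly {L : Type*} [Field L] (a b c d e h x t : L)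
    (f g : Polynomial L) :
    MvPolynomial.eval ![x, t]
      (MvPolynomial.pderiv 1 (MvPolynomial.pderiv 0 (Hpoly a b c d e h f g))) =
      f.derivative.eval t
        - 2 * (a * t + b) * (a * x + 3 * c * t ^ 2 + 2 * d * t + e)
        - 2 * a * (a * x * t + b * x + c * t ^ 3 + d * t ^ 2 + e * t + h) := by
  have h01 : MvPolynomial.pderiv (R := L) (0 : Fin 2) (MvPolynomial.X 1) = 0 :=
    MvPolynomial.pderiv_X_of_ne (by decide)
  have h10 : MvPolynomial.pderiv (R := L) (1 : Fin 2) (MvPolynomial.X 0) = 0 :=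
    MvPolynomial.pderiv_X_of_ne (by decide)
  have h2 : MvPolynomial.pderiv (R := L) (1 : Fin 2) 2 = 0 :=
    Derivation.map_natCast _ 2
  have h3 : MvPolynomial.pderiv (R := L) (1 : Fin 2) 3 = 0 :=
    Derivation.map_natCast _ 3
  simp [Hpoly, MvPolynomial.eval_polynomial_aeval, Derivation.leibniz_pow, h01, h10, h2, h3]
  ring

/-- Condition (C5): with `x₀ = (at₀+b)²/3` and the displayed values of `d` and `e`,
the mixed second partial derivative `∂²H/∂t∂x` vanishes at `(x₀, t₀)`. -/
theorem stmt_3 {L : Type*} [Field L] [CharZero L] (f g : Polynomial L)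
    (a b c h t₀ : L) (ht : t₀ * (a * t₀ + b) ≠ 0)
    (x₀ d e : L) (hx₀ : x₀ = (a * t₀ + b) ^ 2 / 3)
    (hd : d = ((a * t₀ + b) ^ 4 * (b - 2 * a * t₀) / 3
        + 2 * (a * t₀ + b) ^ 2 * (h - 2 * c * t₀ ^ 3)
        + (a * t₀ + b) * (t₀ * f.derivative.eval t₀ - f.eval t₀)
        - a * t₀ * f.eval t₀) / (2 * t₀ ^ 2 * (a * t₀ + b) ^ 2))
    (he : e = (f.eval t₀ - (a * t₀ + b) ^ 4 / 3
        - 2 * (a * t₀ + b) * (c * t₀ ^ 3 + d * t₀ ^ 2 + h)) / (2 * t₀ * (a * t₀ + b))) :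
    MvPolynomial.eval ![x₀, t₀]
      (MvPolynomial.pderiv 1 (MvPolynomial.pderiv 0 (Hpoly a b c d e h f g))) = 0 := by
  rw [eval_pderiv_pderiv_Hpoly]
  obtain ⟨ht₀, hs⟩ := mul_ne_zero_iff.mp ht
  generalize f.derivative.eval t₀ = f₁ at *
  generalize f.eval t₀ = f₀ at *
  obtain ⟨s, hsdef⟩ : ∃ s, s = a * t₀ + b := ⟨_, rfl⟩
  obtain rfl : b = s - a * t₀ := by rw [hsdef]; ring
  rw [← hsdef] at *
  subst he hd hx₀
  field_simp
  ring
end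

section
/- Let L be a field of characteristic zero, let f, g ∈ L[t] with deg f ≤ 4 and deg g ≤ 6, and let a, b, t₀ ∈ L with t₀ ≠ 0, a·t₀+b ≠ 0, and 3·f(t₀) + (a·t₀+b)⁴ ≠ 0. Assume P(t₀) = 0 and P′(t₀) = 0 (i.e. P has a double root at t₀). Then for every h ∈ L there exist c, d, e ∈ L such that, at the point (x₀, t₀) with x₀ := (a·t₀+b)²/3, the polynomial H and all of its first and second formal partial derivatives ∂H/∂x, ∂H/∂t, ∂²H/∂x², ∂²H/∂x∂t, ∂²H/∂t² vanish; that is, the trisection y = a·x·t + b·x + c·t³ + d·t² + e·t + h on the surface y² = x³ + f(t)·x + g(t) has a point of multiplicity at least three at t = t₀. -/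
theorem exists_cubic_coeffs {L : Type*} [Field L] [CharZero L] {t : L} (ht : t ≠ 0) (A B C : L) :
    ∃ c d e : L, c * t ^ 3 + d * t ^ 2 + e * t = A ∧ 3 * c * t ^ 2 + 2 * d * t + e = B ∧
      6 * c * t + 2 * d = C := by
  refine ⟨(A - t * B + t ^ 2 * C / 2) / t ^ 3, C / 2 - 3 * ((A - t * B + t ^ 2 * C / 2) / t ^ 2),
    B - t * C + 3 * ((A - t * B + t ^ 2 * C / 2) / t), ?_, ?_, ?_⟩ <;> field_simp <;> ring

theorem MvPolynomial.eval_aeval_X {L σ : Type*} [CommSemiring L] (v : σ → L) (j : σ)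
    (f : Polynomial L) :
    eval v (Polynomial.aeval (X j) f) = f.eval (v j) := by
  rw [Polynomial.aeval_def, Polynomial.hom_eval₂, eval_X, algebraMap_eq,
    show (eval v).comp C = RingHom.id L from RingHom.ext (eval_C (f := v)), Polynomial.eval₂_id]

/-- Lemma 3.3: if `P` has a double root at `t₀` (and the nondegeneracy conditions hold),
then for every `h` there are coefficients `c, d, e` such that the trisection
`y = axt + bx + ct³ + dt² + et + h` has a point of multiplicity at least three over `t₀`:
`H` and all its first and second formal partial derivatives vanish at `(x₀, t₀)` with
`x₀ = (at₀+b)²/3`. -/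
theorem stmt_4 {L : Type*} [Field L] [CharZero L] (f g : Polynomial L)
    (hf : f.degree ≤ 4) (hg : g.degree ≤ 6)
    (a b t₀ : L) (ht₀ : t₀ ≠ 0) (hab : a * t₀ + b ≠ 0)
    (hfab : 3 * f.eval t₀ + (a * t₀ + b) ^ 4 ≠ 0)
    (hP : (Ppoly a b f g).eval t₀ = 0)
    (hP' : (Ppoly a b f g).derivative.eval t₀ = 0) :
    ∀ h : L, ∃ c d e : L,
      MvPolynomial.eval ![(a * t₀ + b) ^ 2 / 3, t₀] (Hpoly a b c d e h f g) = 0 ∧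
      MvPolynomial.eval ![(a * t₀ + b) ^ 2 / 3, t₀]
        (MvPolynomial.pderiv 0 (Hpoly a b c d e h f g)) = 0 ∧
      MvPolynomial.eval ![(a * t₀ + b) ^ 2 / 3, t₀]
        (MvPolynomial.pderiv 1 (Hpoly a b c d e h f g)) = 0 ∧
      MvPolynomial.eval ![(a * t₀ + b) ^ 2 / 3, t₀]
        (MvPolynomial.pderiv 0 (MvPolynomial.pderiv 0 (Hpoly a b c d e h f g))) = 0 ∧
      MvPolynomial.eval ![(a * t₀ + b) ^ 2 / 3, t₀]
        (MvPolynomial.pderiv 1 (MvPolynomial.pderiv 0 (Hpoly a b c d e h f g))) = 0 ∧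
      MvPolynomial.eval ![(a * t₀ + b) ^ 2 / 3, t₀]
        (MvPolynomial.pderiv 1 (MvPolynomial.pderiv 1 (Hpoly a b c d e h f g))) = 0 := by
  intro h
  simp only [Ppoly, Polynomial.derivative_add, Polynomial.derivative_mul, Polynomial.derivative_pow,
    Polynomial.derivative_neg, Polynomial.derivative_C, Polynomial.derivative_X,
    Polynomial.eval_add, Polynomial.eval_mul, Polynomial.eval_pow, Polynomial.eval_neg,
    Polynomial.eval_C, Polynomial.eval_X, Polynomial.eval_zero, Polynomial.eval_one] at hP hP'
  obtain ⟨m, hm⟩ : ∃ m, m = a * t₀ + b := ⟨_, rfl⟩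
  rw [← hm] at hab hfab hP hP' ⊢
  obtain ⟨Y, hY⟩ : ∃ Y, Y = (m ^ 4 / 3 + f.eval t₀) / (2 * m) := ⟨_, rfl⟩
  obtain ⟨Y₁, hY₁⟩ : ∃ Y₁, Y₁ = (f.derivative.eval t₀ / 2 - Y * a) / m := ⟨_, rfl⟩
  obtain ⟨Y₂, hY₂⟩ : ∃ Y₂, Y₂ = ((f.derivative.derivative.eval t₀ * (m ^ 2 / 3)
    + g.derivative.derivative.eval t₀) / 2 - Y₁ ^ 2) / Y := ⟨_, rfl⟩
  have hY0 : Y ≠ 0 := by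
    rw [hY]
    refine div_ne_zero (fun hz => hfab ?_) (mul_ne_zero two_ne_zero hab)
    linear_combination 3 * hz
  have hF : f.eval t₀ = 2 * m * Y - m ^ 4 / 3 := by
    rw [hY]; field_simp; ring
  have hF₁ : f.derivative.eval t₀ = 2 * (m * Y₁ + a * Y) := by
    rw [hY₁]; field_simp; ring
  have hF₂ : f.derivative.derivative.eval t₀ * (m ^ 2 / 3) + g.derivative.derivative.eval t₀
      = 2 * (Y₁ ^ 2 + Y * Y₂) := by
    rw [hY₂]; field_simp; ring
  have hG : g.eval t₀ = Y ^ 2 - (m ^ 2 / 3) ^ 3 - f.eval t₀ * (m ^ 2 / 3) := by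
    apply mul_left_cancel₀ (pow_ne_zero 2 hab)
    rw [hF] at hP ⊢
    linear_combination hP
  have hG₁ : g.derivative.eval t₀ = 2 * Y * Y₁ - f.derivative.eval t₀ * (m ^ 2 / 3) := by
    apply mul_left_cancel₀ (pow_ne_zero 2 hab)
    rw [hG, hF, hF₁] at hP'
    rw [hF₁]
    norm_num at hP'
    linear_combination hP'
  obtain ⟨c, d, e, h₀, h₁, h₂⟩ :=
    exists_cubic_coeffs ht₀ (Y - m * (m ^ 2 / 3) - h) (Y₁ - a * (m ^ 2 / 3)) Y₂
  have hy : a * (m ^ 2 / 3) * t₀ + b * (m ^ 2 / 3) + c * t₀ ^ 3 + d * t₀ ^ 2 + e * t₀ + h = Y := by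
    linear_combination h₀ - m ^ 2 / 3 * hm
  have hp₂ (i : Fin 2) : MvPolynomial.pderiv i (2 : MvPolynomial (Fin 2) L) = 0 :=
    (MvPolynomial.pderiv i).map_natCast 2
  have hp₃ (i : Fin 2) : MvPolynomial.pderiv i (3 : MvPolynomial (Fin 2) L) = 0 :=
    (MvPolynomial.pderiv i).map_natCast 3
  refine ⟨c, d, e, ?_⟩
  simp [Hpoly, MvPolynomial.eval_aeval_X, MvPolynomial.pderiv_X, hp₂, hp₃, hy]
  have hm' : t₀ * a + b = m := by rw [hm, mul_comm]
  have hy₁ : a * (m ^ 2 / 3) + c * (3 * t₀ ^ 2) + d * (2 * t₀) + e = Y₁ := by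
    linear_combination h₁
  simp only [hm', hy₁]
  refine ⟨?_, ?_, ?_, ?_, ?_, ?_⟩
  · linear_combination hG
  · linear_combination hF
  · linear_combination hG₁
  · ring
  · linear_combination hF₁
  · linear_combination hF₂ - 2 * Y * h₂
end

section
/- Let k be a field of characteristic zero, let f, g ∈ k[t], and let a, t₀ ∈ k with a ≠ 0 and t₀ ≠ 0. Suppose (t − t₀) divides f(t) − a⁴·t⁴/3 and (t − t₀)² divides g(t) + a⁶·t⁶/27 in k[t]. Then, taking b = 0, the polynomial P(t) is divisible by (t − t₀)², and f(t₀) = a⁴·t₀⁴/3; in particular f(t₀) ≠ −(a·t₀ + 0)⁴/3. -/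
/-- For `b = 0`, the polynomial `P` is a combination of the square of `f - a⁴t⁴/3` and of
`g + a⁶t⁶/27`. -/
theorem Ppoly_zero_eq {k : Type*} [Field k] [CharZero k] (a : k) (f g : Polynomial k) :
    Ppoly a 0 f g =
      -Polynomial.C (1 / 4 : k) *
          (f - Polynomial.C (1 / 3 : k) * Polynomial.C a ^ 4 * Polynomial.X ^ 4) ^ 2
        + (Polynomial.C a * Polynomial.X) ^ 2 *
          (g + Polynomial.C (1 / 27 : k) * Polynomial.C a ^ 6 * Polynomial.X ^ 6) := by
  have h_scale (n : ℕ) (x : k) (hx : x = n * (1 / 108)) :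
      Polynomial.C x = (n : Polynomial k) * Polynomial.C (1 / 108 : k) := by
    rw [hx, Polynomial.C_mul, Polynomial.C_eq_natCast]
  have h_one : (108 : Polynomial k) * Polynomial.C (1 / 108 : k) = 1 := by
    simpa using (h_scale 108 1 (by norm_num)).symm
  rw [Ppoly, h_scale 27 (1 / 4) (by norm_num), h_scale 18 (1 / 6) (by norm_num),
    h_scale 36 (1 / 3) (by norm_num), h_scale 4 (1 / 27) (by norm_num), Polynomial.C_0]
  push_cast
  generalize Polynomial.C (1 / 108 : k) = c at h_one ⊢
  generalize Polynomial.C a = A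
  linear_combination (-18 * c * f * (A * Polynomial.X) ^ 4
    + 3 * c * (108 * c + 1) * (A * Polynomial.X) ^ 8) * h_one

/-- Corollary 1.2: if `(t − t₀)` divides `f − a⁴t⁴/3` and `(t − t₀)²` divides
`g + a⁶t⁶/27`, then with `b = 0` the polynomial `P` is divisible by `(t − t₀)²`, and
`f(t₀) = a⁴t₀⁴/3 ≠ −(a·t₀ + 0)⁴/3`. -/
theorem stmt_10 {k : Type*} [Field k] [CharZero k] (f g : Polynomial k)
    (a t₀ : k) (ha : a ≠ 0) (ht₀ : t₀ ≠ 0)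
    (hf : (Polynomial.X - Polynomial.C t₀) ∣
      (f - Polynomial.C (1 / 3 : k) * Polynomial.C a ^ 4 * Polynomial.X ^ 4))
    (hg : (Polynomial.X - Polynomial.C t₀) ^ 2 ∣
      (g + Polynomial.C (1 / 27 : k) * Polynomial.C a ^ 6 * Polynomial.X ^ 6)) :
    (Polynomial.X - Polynomial.C t₀) ^ 2 ∣ Ppoly a 0 f g ∧
    f.eval t₀ = a ^ 4 * t₀ ^ 4 / 3 ∧
    f.eval t₀ ≠ -(a * t₀ + 0) ^ 4 / 3 := by
  obtain ⟨q, hq⟩ := hf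
  obtain ⟨r, hr⟩ := hg
  have hf_eval : f.eval t₀ = a ^ 4 * t₀ ^ 4 / 3 := by
    have h := congrArg (Polynomial.eval t₀) hq
    simp only [Polynomial.eval_sub, Polynomial.eval_mul, Polynomial.eval_pow, Polynomial.eval_C,
      Polynomial.eval_X, sub_self, zero_mul] at h
    linear_combination h
  refine ⟨?_, hf_eval, ?_⟩
  · rw [Ppoly_zero_eq, hq, hr]
    exact ⟨-Polynomial.C (1 / 4 : k) * q ^ 2 + (Polynomial.C a * Polynomial.X) ^ 2 * r, by ring⟩
  · rw [hf_eval]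
    intro h
    have h_zero : (a * t₀) ^ 4 = 0 := by linear_combination (3 / 2 : k) * h
    exact pow_ne_zero 4 (mul_ne_zero ha ht₀) h_zero
end

section
/- Let k be a field of characteristic zero. For α, h ∈ k define f(t) := (4/3)·t⁴ − 1 and g_α(t) := (α − 1/27)·t⁶ + (−2α + 1)·t⁵ + (α − 1)·t⁴ + (−16α − 890/27)·t² + (32α + 1753/27)·t − 16α − 863/27, and set C₃ := −(45/2)·α − h − 454/9, C₂ := 45·α + 3·h + 926/9, C₁ := −(45/2)·α − 3·h − 472/9. Let H(x,t) := x³ + f(t)·x + g_α(t) − (x·t + C₃·t³ + C₂·t² + C₁·t + h)². Then H and all of its first and second formal partial derivatives with respect to x and t vanish at the point (x,t) = (1/3, 1); that is, each trisection T_h has a triple singularity at Q = (1/3, 1/3, 1). -/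
namespace MvPolynomial

variable {σ R : Type*} [CommSemiring R]

theorem eval_aeval_X_s11 (v : σ → R) (i : σ) (p : Polynomial R) :
    eval v (Polynomial.aeval (X i : MvPolynomial σ R) p) = p.eval (v i) := by
  rw [← aeval_eq_eval]
  simp [← Polynomial.aeval_algHom_apply]

theorem pderiv_ofNat (i : σ) (n : ℕ) [n.AtLeastTwo] :
    pderiv i (ofNat(n) : MvPolynomial σ R) = 0 :=
  Derivation.map_natCast (pderiv i) n

end MvPolynomial

open Polynomial in
/-- Example 1.3: on the surface `E_α : y² = x³ + f(t)x + g_α(t)` with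
`f(t) = (4/3)t⁴ − 1`, each trisection `T_h : y = xt + C₃t³ + C₂t² + C₁t + h` has a
triple singularity at `Q = (1/3, 1/3, 1)`: the polynomial `H` and all of its first and
second formal partial derivatives vanish at `(x,t) = (1/3, 1)`. -/
theorem stmt_11 {k : Type*} [Field k] [CharZero k] (α h : k)
    (f gα : Polynomial k)
    (hf : f = C (4 / 3 : k) * X ^ 4 - 1)
    (hg : gα = C (α - 1 / 27) * X ^ 6 + C (-2 * α + 1) * X ^ 5 + C (α - 1) * X ^ 4
      + C (-16 * α - 890 / 27) * X ^ 2 + C (32 * α + 1753 / 27) * X - C (16 * α + 863 / 27))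
    (C₃ C₂ C₁ : k)
    (hC₃ : C₃ = -(45 / 2) * α - h - 454 / 9)
    (hC₂ : C₂ = 45 * α + 3 * h + 926 / 9)
    (hC₁ : C₁ = -(45 / 2) * α - 3 * h - 472 / 9) :
    MvPolynomial.eval ![(1 : k) / 3, 1] (Hpoly 1 0 C₃ C₂ C₁ h f gα) = 0 ∧
    MvPolynomial.eval ![(1 : k) / 3, 1]
      (MvPolynomial.pderiv 0 (Hpoly 1 0 C₃ C₂ C₁ h f gα)) = 0 ∧
    MvPolynomial.eval ![(1 : k) / 3, 1]
      (MvPolynomial.pderiv 1 (Hpoly 1 0 C₃ C₂ C₁ h f gα)) = 0 ∧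
    MvPolynomial.eval ![(1 : k) / 3, 1]
      (MvPolynomial.pderiv 0 (MvPolynomial.pderiv 0 (Hpoly 1 0 C₃ C₂ C₁ h f gα))) = 0 ∧
    MvPolynomial.eval ![(1 : k) / 3, 1]
      (MvPolynomial.pderiv 1 (MvPolynomial.pderiv 0 (Hpoly 1 0 C₃ C₂ C₁ h f gα))) = 0 ∧
    MvPolynomial.eval ![(1 : k) / 3, 1]
      (MvPolynomial.pderiv 1 (MvPolynomial.pderiv 1 (Hpoly 1 0 C₃ C₂ C₁ h f gα))) = 0 := by
  have hf₀ : f.eval 1 = 1 / 3 := by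
    simp [hf]; ring
  have hf₁ : (derivative f).eval 1 = 16 / 3 := by
    simp [hf]; ring
  have hf₂ : (derivative (derivative f)).eval 1 = 16 := by
    simp [hf]; ring
  have hg₀ : gα.eval 1 = -1 / 27 := by
    simp [hg]; ring
  have hg₁ : (derivative gα).eval 1 = -2 / 9 := by
    simp [hg]; ring
  have hg₂ : (derivative (derivative gα)).eval 1 = -30 * α - 1594 / 27 := by
    simp [hg]; ring
  refine ⟨?_, ?_, ?_, ?_, ?_, ?_⟩ <;>
  · simp [Hpoly, MvPolynomial.eval_aeval_X_s11, MvPolynomial.pderiv_ofNat,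
      hf₀, hf₁, hf₂, hg₀, hg₁, hg₂, hC₁, hC₂, hC₃]
    ring
end

section
/- Let k be a field of characteristic zero and let h ∈ k. Define f(t) := t⁴ + t³ + t² − (68/3)·t + 43/3 and g(t) := t⁶ + t⁵ − (2783/144)·t⁴ + (4175/216)·t³ + (501/16)·t² − (433/12)·t + 811/108, and let H(x,t) := x³ + f(t)·x + g(t) − (x·t + x + (13/4 − h/2)·t³ + (2h − 103/12)·t² + (8/3 − 5h/2)·t + h)². Then (i) H and all of its first and second formal partial derivatives with respect to x and t vanish at (x,t) = (4/3, 1), and (ii) H and both of its first formal partial derivatives vanish at (x,t) = (1, 2). That is, each trisection T_h has a triple singularity at Q = (4/3, 0, 1) and a double singularity at R = (1, 0, 2). -/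
theorem MvPolynomial.pderiv_ofNat_s13 {σ R : Type*} [CommSemiring R] (i : σ) (n : ℕ)
    [n.AtLeastTwo] :
    MvPolynomial.pderiv i (ofNat(n) : MvPolynomial σ R) = 0 :=
  Derivation.map_natCast _ n

set_option maxHeartbeats 2000000 in
open Polynomial in
/-- Example 5.8: each trisection
`T_h : y = xt + x + (13/4 − h/2)t³ + (2h − 103/12)t² + (8/3 − 5h/2)t + h` on the surface
`E : y² = x³ + f(t)x + g(t)` has a triple singularity at `Q = (4/3, 0, 1)` and a double
singularity at `R = (1, 0, 2)`. -/
theorem stmt_13 {k : Type*} [Field k] [CharZero k] (h : k)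
    (f g : Polynomial k)
    (hf : f = X ^ 4 + X ^ 3 + X ^ 2 - C (68 / 3 : k) * X + C (43 / 3 : k))
    (hg : g = X ^ 6 + X ^ 5 - C (2783 / 144 : k) * X ^ 4 + C (4175 / 216 : k) * X ^ 3
      + C (501 / 16 : k) * X ^ 2 - C (433 / 12 : k) * X + C (811 / 108 : k)) :
    (MvPolynomial.eval ![(4 : k) / 3, 1]
        (Hpoly 1 1 (13 / 4 - h / 2) (2 * h - 103 / 12) (8 / 3 - 5 * h / 2) h f g) = 0 ∧
      MvPolynomial.eval ![(4 : k) / 3, 1] (MvPolynomial.pderiv 0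
        (Hpoly 1 1 (13 / 4 - h / 2) (2 * h - 103 / 12) (8 / 3 - 5 * h / 2) h f g)) = 0 ∧
      MvPolynomial.eval ![(4 : k) / 3, 1] (MvPolynomial.pderiv 1
        (Hpoly 1 1 (13 / 4 - h / 2) (2 * h - 103 / 12) (8 / 3 - 5 * h / 2) h f g)) = 0 ∧
      MvPolynomial.eval ![(4 : k) / 3, 1] (MvPolynomial.pderiv 0 (MvPolynomial.pderiv 0
        (Hpoly 1 1 (13 / 4 - h / 2) (2 * h - 103 / 12) (8 / 3 - 5 * h / 2) h f g))) = 0 ∧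
      MvPolynomial.eval ![(4 : k) / 3, 1] (MvPolynomial.pderiv 1 (MvPolynomial.pderiv 0
        (Hpoly 1 1 (13 / 4 - h / 2) (2 * h - 103 / 12) (8 / 3 - 5 * h / 2) h f g))) = 0 ∧
      MvPolynomial.eval ![(4 : k) / 3, 1] (MvPolynomial.pderiv 1 (MvPolynomial.pderiv 1
        (Hpoly 1 1 (13 / 4 - h / 2) (2 * h - 103 / 12) (8 / 3 - 5 * h / 2) h f g))) = 0) ∧
    (MvPolynomial.eval ![(1 : k), 2]
        (Hpoly 1 1 (13 / 4 - h / 2) (2 * h - 103 / 12) (8 / 3 - 5 * h / 2) h f g) = 0 ∧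
      MvPolynomial.eval ![(1 : k), 2] (MvPolynomial.pderiv 0
        (Hpoly 1 1 (13 / 4 - h / 2) (2 * h - 103 / 12) (8 / 3 - 5 * h / 2) h f g)) = 0 ∧
      MvPolynomial.eval ![(1 : k), 2] (MvPolynomial.pderiv 1
        (Hpoly 1 1 (13 / 4 - h / 2) (2 * h - 103 / 12) (8 / 3 - 5 * h / 2) h f g)) = 0) := by
  subst hf hg
  refine ⟨⟨?_, ?_, ?_, ?_, ?_, ?_⟩, ?_, ?_, ?_⟩ <;>
  · simp [Hpoly, MvPolynomial.algebraMap_eq, MvPolynomial.pderiv_X,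
      MvPolynomial.pderiv_ofNat_s13, Derivation.leibniz, Derivation.leibniz_pow]
    field_simp
    ring
end

section
/- Let k be a field of characteristic zero, let a, b, t₀ ∈ k with t₀·(a·t₀+b) ≠ 0, and let f = f₄t⁴ + f₃t³ + f₂t² + f₁t + f₀ ∈ k[t] satisfy f(t₀) = −(a·t₀+b)⁴/3. Let g₃, g₄, g₅, g₆ ∈ k be arbitrary and define: g₂ := −(1/(2·(a·t₀+b)²))·[ (a·t₀+b)⁴·(4t₀²f₄ + 2t₀f₃ + (2/3)f₂) + 2·(a·t₀+b)²·(15t₀⁴g₆ + 10t₀³g₅ + 6t₀²g₄ + 3t₀g₃) − 8·(t₀³f₄ + (3/4)t₀²f₃ + (1/2)t₀f₂ + (1/4)f₁)² ]; g₁ := −(a·t₀+b)²·((4/3)t₀³f₄ + t₀²f₃ + (2/3)t₀f₂ + (1/3)f₁) − 6t₀⁵g₆ − 5t₀⁴g₅ − 4t₀³g₄ − 3t₀²g₃ − 2t₀g₂; g₀ := (2/27)·(a·t₀+b)⁶ − t₀⁶g₆ − t₀⁵g₅ − t₀⁴g₄ − t₀³g₃ − t₀²g₂ − t₀g₁. Set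 g := g₆t⁶ + g₅t⁵ + g₄t⁴ + g₃t³ + g₂t² + g₁t + g₀ ∈ k[t]. Then (t − t₀)³ divides 4·f(t)³ + 27·g(t)² in k[t]. -/
/-- If `4f³ + 27g²` vanishes to order three in `u` for the second-order truncations of `f` and `g`,
then `u ^ 3` divides `4f³ + 27g²`. -/
theorem cube_dvd_disc_of_expansion {R : Type*} [CommRing R] {u f g p q A₀ A₁ A₂ B₀ B₁ B₂ : R}
    (hf : f = A₀ + A₁ * u + A₂ * u ^ 2 + u ^ 3 * p)
    (hg : g = B₀ + B₁ * u + B₂ * u ^ 2 + u ^ 3 * q)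
    (h₀ : 4 * A₀ ^ 3 + 27 * B₀ ^ 2 = 0)
    (h₁ : 12 * A₀ ^ 2 * A₁ + 54 * B₀ * B₁ = 0)
    (h₂ : 12 * A₀ ^ 2 * A₂ + 12 * A₀ * A₁ ^ 2 + 27 * B₁ ^ 2 + 54 * B₀ * B₂ = 0) :
    u ^ 3 ∣ 4 * f ^ 3 + 27 * g ^ 2 := by
  obtain ⟨F, hF⟩ : ∃ F, F = A₀ + A₁ * u + A₂ * u ^ 2 := ⟨_, rfl⟩
  obtain ⟨G, hG⟩ : ∃ G, G = B₀ + B₁ * u + B₂ * u ^ 2 := ⟨_, rfl⟩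
  have key : u ^ 3 ∣ 4 * F ^ 3 + 27 * G ^ 2 := by
    refine ⟨4 * (A₁ ^ 3 + 6 * A₀ * A₁ * A₂ + (3 * A₁ ^ 2 * A₂ + 3 * A₀ * A₂ ^ 2) * u
      + 3 * A₁ * A₂ ^ 2 * u ^ 2 + A₂ ^ 3 * u ^ 3) + 27 * (2 * B₁ * B₂ + B₂ ^ 2 * u), ?_⟩
    rw [hF, hG]
    linear_combination h₀ + u * h₁ + u ^ 2 * h₂
  have hsplit : 4 * f ^ 3 + 27 * g ^ 2 = (4 * F ^ 3 + 27 * G ^ 2)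
      + u ^ 3 * (4 * p * (f ^ 2 + f * F + F ^ 2) + 27 * q * (g + G)) := by
    have hf' : f = F + u ^ 3 * p := by rw [hf, hF]
    have hg' : g = G + u ^ 3 * q := by rw [hg, hG]
    rw [hf', hg']
    ring
  rw [hsplit]
  exact dvd_add key (dvd_mul_right _ _)


open Polynomial in
/-- The computational core of Lemma 5.6: under the displayed coefficient conditions, forced
by a trisection with a triple singularity in the degenerate case `f(t₀) = −(at₀+b)⁴/3`, the
discriminant `4f³ + 27g²` of the fibration `y² = x³ + f(t)x + g(t)` is divisible by
`(t − t₀)³`. -/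
theorem stmt_14 {k : Type*} [Field k] [CharZero k]
    (a b t₀ : k) (ht : t₀ * (a * t₀ + b) ≠ 0)
    (f₀ f₁ f₂ f₃ f₄ : k) (f : Polynomial k)
    (hf : f = C f₄ * X ^ 4 + C f₃ * X ^ 3 + C f₂ * X ^ 2 + C f₁ * X + C f₀)
    (hft₀ : f.eval t₀ = -(a * t₀ + b) ^ 4 / 3)
    (g₀ g₁ g₂ g₃ g₄ g₅ g₆ : k) (g : Polynomial k)
    (hg₂ : g₂ = -(1 / (2 * (a * t₀ + b) ^ 2)) *
      ((a * t₀ + b) ^ 4 * (4 * t₀ ^ 2 * f₄ + 2 * t₀ * f₃ + (2 / 3) * f₂)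
        + 2 * (a * t₀ + b) ^ 2 *
          (15 * t₀ ^ 4 * g₆ + 10 * t₀ ^ 3 * g₅ + 6 * t₀ ^ 2 * g₄ + 3 * t₀ * g₃)
        - 8 * (t₀ ^ 3 * f₄ + (3 / 4) * t₀ ^ 2 * f₃ + (1 / 2) * t₀ * f₂ + (1 / 4) * f₁) ^ 2))
    (hg₁ : g₁ = -(a * t₀ + b) ^ 2 *
        ((4 / 3) * t₀ ^ 3 * f₄ + t₀ ^ 2 * f₃ + (2 / 3) * t₀ * f₂ + (1 / 3) * f₁)
      - 6 * t₀ ^ 5 * g₆ - 5 * t₀ ^ 4 * g₅ - 4 * t₀ ^ 3 * g₄ - 3 * t₀ ^ 2 * g₃ - 2 * t₀ * g₂)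
    (hg₀ : g₀ = (2 / 27) * (a * t₀ + b) ^ 6
      - t₀ ^ 6 * g₆ - t₀ ^ 5 * g₅ - t₀ ^ 4 * g₄ - t₀ ^ 3 * g₃ - t₀ ^ 2 * g₂ - t₀ * g₁)
    (hg : g = C g₆ * X ^ 6 + C g₅ * X ^ 5 + C g₄ * X ^ 4 + C g₃ * X ^ 3
      + C g₂ * X ^ 2 + C g₁ * X + C g₀) :
    (X - C t₀) ^ 3 ∣ 4 * f ^ 3 + 27 * g ^ 2 := by
  have hs : a * t₀ + b ≠ 0 := right_ne_zero_of_mul ht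
  generalize a * t₀ + b = s at *
  obtain ⟨A₁, hA₁⟩ : ∃ x, x = 4 * t₀ ^ 3 * f₄ + 3 * t₀ ^ 2 * f₃ + 2 * t₀ * f₂ + f₁ := ⟨_, rfl⟩
  obtain ⟨A₂, hA₂⟩ : ∃ x, x = 6 * t₀ ^ 2 * f₄ + 3 * t₀ * f₃ + f₂ := ⟨_, rfl⟩
  have hA₀ : t₀ ^ 4 * f₄ + t₀ ^ 3 * f₃ + t₀ ^ 2 * f₂ + t₀ * f₁ + f₀ = -s ^ 4 / 3 := by
    rw [← hft₀, hf]
    simp only [eval_add, eval_mul, eval_C, eval_pow, eval_X]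
    ring
  have hB₀ : t₀ ^ 6 * g₆ + t₀ ^ 5 * g₅ + t₀ ^ 4 * g₄ + t₀ ^ 3 * g₃ + t₀ ^ 2 * g₂ + t₀ * g₁ + g₀
      = 2 / 27 * s ^ 6 := by
    rw [hg₀]
    ring
  have hB₁ : 6 * t₀ ^ 5 * g₆ + 5 * t₀ ^ 4 * g₅ + 4 * t₀ ^ 3 * g₄ + 3 * t₀ ^ 2 * g₃ + 2 * t₀ * g₂ + g₁
      = -s ^ 2 * A₁ / 3 := by
    rw [hg₁, hA₁]
    ring
  have hB₂ : 15 * t₀ ^ 4 * g₆ + 10 * t₀ ^ 3 * g₅ + 6 * t₀ ^ 2 * g₄ + 3 * t₀ * g₃ + g₂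
      = -s ^ 2 * A₂ / 3 + A₁ ^ 2 / (4 * s ^ 2) := by
    rw [hg₂, hA₁, hA₂]
    field_simp
    ring
  have hfu : f = C (-s ^ 4 / 3) + C A₁ * (X - C t₀) + C A₂ * (X - C t₀) ^ 2
      + (X - C t₀) ^ 3 * (C (4 * t₀ * f₄ + f₃) + C f₄ * (X - C t₀)) := by
    rw [hf, ← hA₀, hA₁, hA₂]
    simp only [map_add, map_mul, map_pow, map_ofNat]
    ring
  have hgu : g = C (2 / 27 * s ^ 6) + C (-s ^ 2 * A₁ / 3) * (X - C t₀)
      + C (-s ^ 2 * A₂ / 3 + A₁ ^ 2 / (4 * s ^ 2)) * (X - C t₀) ^ 2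
      + (X - C t₀) ^ 3 * (C (20 * t₀ ^ 3 * g₆ + 10 * t₀ ^ 2 * g₅ + 4 * t₀ * g₄ + g₃)
        + C (15 * t₀ ^ 2 * g₆ + 5 * t₀ * g₅ + g₄) * (X - C t₀)
        + C (6 * t₀ * g₆ + g₅) * (X - C t₀) ^ 2 + C g₆ * (X - C t₀) ^ 3) := by
    rw [hg, ← hB₀, ← hB₁, ← hB₂]
    simp only [map_add, map_mul, map_pow, map_ofNat]
    ring
  refine cube_dvd_disc_of_expansion hfu hgu ?_ ?_ ?_
  all_goals
    simp only [← map_ofNat (C : k →+* k[X]), ← map_pow, ← map_mul, ← map_add]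
    rw [C_eq_zero]
    field_simp
    ring
end
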